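/- Let a_n = ln(1 + 1/(n+1)) for n ≥ 0. Then for every n, a_n(1 - a_n) ≤ a_{n+1} ≤ a_n/(1 + a_n). -/

import Mathlib

/-- The first two terms of the `artanh` series bound `log (1 + 1 / x)` from below. -/
theorem log_one_add_one_div_lower {x : ℝ} (hx : 0 < x) :
    2 / (2 * x + 1) + 2 / (3 * (2 * x + 1) ^ 3) ≤ Real.log (1 + 1 / x) := by
  have h := sum_le_hasSum (Finset.range 2) (fun k _ => by positivity)
    (Real.hasSum_log_one_add_inv hx)
  rw [← one_div] at h
  refine le_trans (le_of_eq ?_) h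
  norm_num [Finset.sum_range_succ]
  field_simp

/-- Comparing the tail of the `artanh` series with a geometric series bounds
`log (1 + 1 / x)` from above. -/
theorem log_one_add_one_div_upper {x : ℝ} (hx : 0 < x) :
    Real.log (1 + 1 / x) ≤ (12 * x ^ 2 + 12 * x + 1) / (6 * x * (x + 1) * (2 * x + 1)) := by
  set s : ℝ := 1 / (2 * x + 1) with hs
  have hs0 : 0 < s := by positivity
  have hs1 : s ^ 2 < 1 := by
    rw [hs, div_pow, one_pow, div_lt_one (by positivity)]
    nlinarith
  have hlog := Real.hasSum_log_one_add_inv hx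
  rw [← one_div] at hlog
  have hgeo := ((hasSum_geometric_of_lt_one (sq_nonneg s) hs1).mul_left (2 / 3 * s)).add
    (hasSum_ite_eq (0 : ℕ) (4 / 3 * s))
  refine (hasSum_le (fun k => ?_) hlog hgeo).trans (le_of_eq ?_)
  · rcases Nat.eq_zero_or_pos k with rfl | hk
    · norm_num [← hs]
      linarith
    · have hk' : (1 : ℝ) ≤ k := by exact_mod_cast hk
      have hcoef : 2 * (1 / (2 * (k : ℝ) + 1)) ≤ 2 / 3 := by
        rw [mul_one_div, div_le_div_iff₀ (by positivity) (by norm_num)]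
        linarith
      rw [if_neg hk.ne', add_zero, ← hs, pow_succ, pow_mul]
      have := mul_le_mul_of_nonneg_right hcoef (show 0 ≤ (s ^ 2) ^ k * s by positivity)
      linarith
  · have h1 : 1 - s ^ 2 = 4 * x * (x + 1) / (2 * x + 1) ^ 2 := by
      rw [hs]
      field_simp
      ring
    rw [h1, hs]
    field_simp
    ring

theorem stmt_2 (a : ℕ → ℝ) (ha : ∀ n, a n = Real.log (1 + 1/((n:ℝ)+1))) :
    ∀ n : ℕ, a n * (1 - a n) ≤ a (n+1) ∧ a (n+1) ≤ a n / (1 + a n) := by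
  intro n
  have hn : (0 : ℝ) ≤ n := n.cast_nonneg
  have hxl := log_one_add_one_div_lower (x := (n : ℝ) + 1) (by positivity)
  have hxu := log_one_add_one_div_upper (x := (n : ℝ) + 1) (by positivity)
  have hyl := log_one_add_one_div_lower (x := (n : ℝ) + 1 + 1) (by positivity)
  have hyu := log_one_add_one_div_upper (x := (n : ℝ) + 1 + 1) (by positivity)
  rw [ha n, ha (n + 1), Nat.cast_succ]
  generalize Real.log (1 + 1 / ((n : ℝ) + 1)) = x at *
  generalize Real.log (1 + 1 / ((n : ℝ) + 1 + 1)) = y at *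
  generalize (n : ℝ) = t at *
  have hx0 : 0 < x := lt_of_lt_of_le (by positivity) hxl
  constructor
  · have hx1 : 2 / (2 * t + 3) ≤ x := by
      refine le_trans ?_ hxl
      rw [show 2 * (t + 1) + 1 = 2 * t + 3 by ring]
      exact le_add_of_nonneg_right (by positivity)
    have hx2 : x ≤ (2 * t + 3) / (2 * (t + 1) * (t + 2)) := by
      refine hxu.trans ?_
      rw [div_le_div_iff₀ (by positivity) (by positivity), ← sub_nonneg]
      ring_nf
      positivity
    have hy1 : 2 / (2 * t + 5) ≤ y := by
      refine le_trans ?_ hyl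
      rw [show 2 * (t + 1 + 1) + 1 = 2 * t + 5 by ring]
      exact le_add_of_nonneg_right (by positivity)
    have h1 : 1 - 2 / (2 * t + 3) = (2 * t + 1) / (2 * t + 3) := by
      field_simp
      ring
    calc x * (1 - x) ≤ x * (1 - 2 / (2 * t + 3)) := by gcongr
      _ ≤ (2 * t + 3) / (2 * (t + 1) * (t + 2)) * (1 - 2 / (2 * t + 3)) := by
        rw [h1]
        gcongr
      _ ≤ 2 / (2 * t + 5) := by
        rw [h1, div_mul_div_comm, div_le_div_iff₀ (by positivity) (by positivity), ← sub_nonneg]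
        ring_nf
        positivity
      _ ≤ y := hy1
  · rw [le_div_iff₀ (by positivity)]
    set Y := (12 * (t + 1 + 1) ^ 2 + 12 * (t + 1 + 1) + 1) /
      (6 * (t + 1 + 1) * (t + 1 + 1 + 1) * (2 * (t + 1 + 1) + 1)) with hY
    set X := 2 / (2 * (t + 1) + 1) + 2 / (3 * (2 * (t + 1) + 1) ^ 3) with hX
    have hY1 : 0 ≤ 1 - Y := by
      rw [hY, sub_nonneg, div_le_one (by positivity), ← sub_nonneg]
      ring_nf
      positivity
    have hXY : Y ≤ X * (1 - Y) := by
      rw [← sub_nonneg, hX, hY]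
      field_simp
      ring_nf
      positivity
    have h1 : y * (1 + x) ≤ Y * (1 + x) := by gcongr
    have h2 : X * (1 - Y) ≤ x * (1 - Y) := by gcongr
    linarith
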